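/- If the data X_1, …, X_n are independent and identically distributed with distribution N(θ_0, 1), then for every t > 0 the expectation over the data of the estimated singular fluctuation of model M_N is exactly E{ν̂(t)} = ((ntv − tv)/(ntv + 1)) · 1/2 + (ntv/(2(ntv + 1)³)) · ((m − θ_0)² + 1/n) + t n v²/(4(ntv + 1)²). -/

import Mathlib

open MeasureTheory ProbabilityTheory Real

/-- Normal likelihood density `p(x | θ) = (2π)^{-1/2} exp(−(x−θ)²/2)`. -/
noncomputable def normalLik (x θ : ℝ) : ℝ :=
  (Real.sqrt (2 * Real.pi))⁻¹ * Real.exp (-(x - θ)^2 / 2)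

/-- Estimated singular fluctuation `ν̂(t) = (t/2)∑ᵢ V^t[log p(Xᵢ|θ)]` of model
`M_N` at inverse temperature `t`, for data `X`, where `V^t` is the variance
under the tempered posterior `N(m_t, v_t)`,
`m_t = (nt·X̄ + m/v)/(nt + 1/v)` and `v_t = (nt + 1/v)⁻¹`. -/
noncomputable def nuHat (n : ℕ) (m v t : ℝ) (X : Fin n → ℝ) : ℝ :=
  let xbar := (∑ i, X i) / n
  let mt := (n * t * xbar + m / v) / (n * t + 1 / v)
  let vt := (n * t + 1 / v)⁻¹
  (t / 2) * ∑ i,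
    ((∫ θ, (Real.log (normalLik (X i) θ))^2 ∂(gaussianReal mt vt.toNNReal)) -
      (∫ θ, Real.log (normalLik (X i) θ) ∂(gaussianReal mt vt.toNNReal))^2)

open scoped NNReal

lemma integrable_pow_gaussianReal (μ : ℝ) (w : ℝ≥0) (k : ℕ) :
    Integrable (fun x : ℝ => x ^ k) (gaussianReal μ w) := by
  have h := (memLp_id_gaussianReal (μ := μ) (v := w) k).integrable_norm_pow'
  rw [← integrable_norm_iff (by fun_prop)]
  simpa using h

/-- Derivative of a function of the form `p s * exp (w * s ^ 2 / 2)`. -/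
lemma deriv_mul_exp_mul_sq_half (w : ℝ) {p q : ℝ → ℝ} (hp : ∀ s, HasDerivAt p (q s) s) :
    deriv (fun s => p s * exp (w * s ^ 2 / 2)) =
      fun s => (q s + w * s * p s) * exp (w * s ^ 2 / 2) := by
  funext s
  have hg : HasDerivAt (fun s : ℝ => w * s ^ 2 / 2) (w * s) s := by
    have := (((hasDerivAt_id s).pow 2).const_mul w).div_const 2
    convert! this using 1
    simp
    ring
  rw [((hp s).fun_mul hg.exp).deriv]
  ring

/-- The first four moments of a centred real Gaussian. -/
lemma moments_gaussianReal_zero (w : ℝ≥0) :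
    ∫ x, x ^ 1 ∂(gaussianReal 0 w) = 0 ∧ ∫ x, x ^ 2 ∂(gaussianReal 0 w) = w ∧
      ∫ x, x ^ 3 ∂(gaussianReal 0 w) = 0 ∧ ∫ x, x ^ 4 ∂(gaussianReal 0 w) = 3 * (w : ℝ) ^ 2 := by
  have hmom (k : ℕ) : ∫ x, x ^ k ∂(gaussianReal 0 w) =
      iteratedDeriv k (fun s : ℝ => 1 * exp (w * s ^ 2 / 2)) 0 := by
    have h := iteratedDeriv_mgf_zero (X := id) (μ := gaussianReal 0 w)
      (by simp [integrableExpSet_id_gaussianReal]) k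
    rw [mgf_id_gaussianReal] at h
    simpa using h.symm
  have h1 : iteratedDeriv 1 (fun s : ℝ => 1 * exp (w * s ^ 2 / 2)) =
      fun s : ℝ => (w * s) * exp (w * s ^ 2 / 2) := by
    rw [iteratedDeriv_one, deriv_mul_exp_mul_sq_half w (fun s => hasDerivAt_const s 1)]
    simp
  have h2 : iteratedDeriv 2 (fun s : ℝ => 1 * exp (w * s ^ 2 / 2)) =
      fun s : ℝ => (w + w ^ 2 * s ^ 2) * exp (w * s ^ 2 / 2) := by
    rw [iteratedDeriv_succ, h1, deriv_mul_exp_mul_sq_half w (q := fun _ => w)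
      (fun s => by simpa using (hasDerivAt_id s).const_mul (w : ℝ))]
    funext s; ring
  have h3 : iteratedDeriv 3 (fun s : ℝ => 1 * exp (w * s ^ 2 / 2)) =
      fun s : ℝ => (3 * w ^ 2 * s + w ^ 3 * s ^ 3) * exp (w * s ^ 2 / 2) := by
    rw [iteratedDeriv_succ, h2, deriv_mul_exp_mul_sq_half w (q := fun s => w ^ 2 * (2 * s))
      (fun s => by simpa using ((hasDerivAt_pow 2 s).const_mul ((w : ℝ) ^ 2)).const_add (w : ℝ))]
    funext s; ring
  have h4 : iteratedDeriv 4 (fun s : ℝ => 1 * exp (w * s ^ 2 / 2)) =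
      fun s : ℝ => (3 * w ^ 2 + 6 * w ^ 3 * s ^ 2 + w ^ 4 * s ^ 4) * exp (w * s ^ 2 / 2) := by
    rw [iteratedDeriv_succ, h3, deriv_mul_exp_mul_sq_half w
      (q := fun s => 3 * w ^ 2 + w ^ 3 * (3 * s ^ 2))
      (fun s => by
        simpa using ((hasDerivAt_id s).const_mul (3 * (w : ℝ) ^ 2)).fun_add
          ((hasDerivAt_pow 3 s).const_mul ((w : ℝ) ^ 3)))]
    funext s; ring
  refine ⟨?_, ?_, ?_, ?_⟩
  · simp
  · rw [hmom, h2]; simp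
  · rw [hmom, h3]; simp
  · rw [hmom, h4]; simp

lemma integral_quartic_gaussianReal_zero (w : ℝ≥0) (a₀ a₁ a₂ a₃ a₄ : ℝ) :
    ∫ x, (a₀ + a₁ * x ^ 1 + a₂ * x ^ 2 + a₃ * x ^ 3 + a₄ * x ^ 4) ∂(gaussianReal 0 w) =
      a₀ + a₂ * w + 3 * a₄ * (w : ℝ) ^ 2 := by
  have hi (a : ℝ) (k : ℕ) : Integrable (fun x : ℝ => a * x ^ k) (gaussianReal 0 w) :=
    (integrable_pow_gaussianReal 0 w k).const_mul a
  have h0 : Integrable (fun _ : ℝ => a₀) (gaussianReal 0 w) := integrable_const _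
  obtain ⟨m1, m2, m3, m4⟩ := moments_gaussianReal_zero w
  rw [integral_add (((h0.fun_add (hi a₁ 1)).fun_add (hi a₂ 2)).fun_add (hi a₃ 3)) (hi a₄ 4),
    integral_add ((h0.fun_add (hi a₁ 1)).fun_add (hi a₂ 2)) (hi a₃ 3),
    integral_add (h0.fun_add (hi a₁ 1)) (hi a₂ 2), integral_add h0 (hi a₁ 1)]
  simp only [integral_const_mul, m1, m2, m3, m4, integral_const, probReal_univ, smul_eq_mul]
  ring

lemma integral_gaussianReal_eq_integral_add (μ : ℝ) (w : ℝ≥0) (f : ℝ → ℝ) :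
    ∫ x, f x ∂(gaussianReal μ w) = ∫ x, f (x + μ) ∂(gaussianReal 0 w) := by
  have h := gaussianReal_map_add_const (μ := 0) (v := w) μ
  rw [zero_add] at h
  rw [← h]
  exact (MeasurableEquiv.addRight μ).measurableEmbedding.integral_map f

lemma log_normalLik (x θ : ℝ) :
    log (normalLik x θ) = log (√(2 * π))⁻¹ - (x - θ) ^ 2 / 2 := by
  rw [normalLik, log_mul (by positivity) (exp_pos _).ne', log_exp]
  ring

/-- Variance of the log-likelihood under a Gaussian law of the parameter. -/
lemma variance_log_normalLik (x μ : ℝ) (w : ℝ≥0) :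
    (∫ θ, (log (normalLik x θ)) ^ 2 ∂(gaussianReal μ w)) -
      (∫ θ, log (normalLik x θ) ∂(gaussianReal μ w)) ^ 2 =
      (w : ℝ) ^ 2 / 2 + (x - μ) ^ 2 * w := by
  simp only [log_normalLik]
  set c := log (√(2 * π))⁻¹
  set d := x - μ with hd
  have h2 : ∫ θ, (c - (x - θ) ^ 2 / 2) ^ 2 ∂(gaussianReal μ w) =
      (c - d ^ 2 / 2) ^ 2 + (d ^ 2 - (c - d ^ 2 / 2)) * w + 3 * (1 / 4) * (w : ℝ) ^ 2 := by
    rw [integral_gaussianReal_eq_integral_add, ← integral_quartic_gaussianReal_zero w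
      ((c - d ^ 2 / 2) ^ 2) (2 * (c - d ^ 2 / 2) * d) (d ^ 2 - (c - d ^ 2 / 2)) (-d) (1 / 4)]
    congr 1 with y
    rw [hd]; ring
  have h1 : ∫ θ, (c - (x - θ) ^ 2 / 2) ∂(gaussianReal μ w) =
      (c - d ^ 2 / 2) + (-1 / 2) * w + 3 * 0 * (w : ℝ) ^ 2 := by
    rw [integral_gaussianReal_eq_integral_add, ← integral_quartic_gaussianReal_zero w
      (c - d ^ 2 / 2) d (-1 / 2) 0 0]
    congr 1 with y
    rw [hd]; ring
  rw [h1, h2]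
  ring

/-- The estimated singular fluctuation as a quadratic polynomial in the data. -/
lemma nuHat_eq {n : ℕ} (hn : n ≠ 0) (m : ℝ) {v t : ℝ} (hv : 0 < v) (ht : 0 < t)
    (X : Fin n → ℝ) :
    nuHat n m v t X =
      t * v / (2 * (n * t * v + 1)) * ∑ i, X i ^ 2 +
      (t * v / (2 * (n * t * v + 1) * n) * (1 / (n * t * v + 1) ^ 2 - 1)) * (∑ i, X i) ^ 2 +
      -(t * v * m / (n * t * v + 1) ^ 3) * ∑ i, X i +
      (t * n * v ^ 2 / (4 * (n * t * v + 1) ^ 2) +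
        n * t * v * m ^ 2 / (2 * (n * t * v + 1) ^ 3)) := by
  have hn' : (0 : ℝ) < n := by positivity
  have hD : 0 < n * t * v + 1 := by positivity
  have hvt : ((n : ℝ) * t + 1 / v)⁻¹ = v / (n * t * v + 1) := by field_simp
  simp only [nuHat, variance_log_normalLik]
  rw [Real.coe_toNNReal _ (by positivity), hvt]
  have hsum (μ : ℝ) : ∑ i, (X i - μ) ^ 2 = ∑ i, X i ^ 2 - 2 * μ * ∑ i, X i + n * μ ^ 2 := by
    simp only [sub_sq, Finset.sum_add_distrib, Finset.sum_sub_distrib, Finset.mul_sum]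
    simp [mul_right_comm]
  rw [Finset.sum_add_distrib, ← Finset.sum_mul, hsum, Finset.sum_const, Finset.card_univ,
    Fintype.card_fin, nsmul_eq_mul, div_eq_mul_inv _ ((n : ℝ) * t + 1 / v), hvt]
  field_simp
  ring

/-- if the data `X₁, …, Xₙ` are i.i.d. `N(θ₀, 1)`, then for every
`t > 0` the expectation over the data of the estimated singular fluctuation is
`E{ν̂(t)} = ((ntv−tv)/(ntv+1))·1/2 + (ntv/(2(ntv+1)³))·((m−θ₀)² + 1/n)
  + tnv²/(4(ntv+1)²)`. -/
theorem normal_expected_nuhat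
    (n : ℕ) (hn : 2 ≤ n) (θ₀ m v : ℝ) (hv : 0 < v)
    (t : ℝ) (ht : 0 < t) :
    ∫ X, nuHat n m v t X ∂(Measure.pi fun _ : Fin n => gaussianReal θ₀ 1) =
      ((n * t * v - t * v) / (n * t * v + 1)) * (1 / 2) +
        (n * t * v / (2 * (n * t * v + 1)^3)) * ((m - θ₀)^2 + 1 / n) +
        t * n * v^2 / (4 * (n * t * v + 1)^2) := by
  have hn0 : n ≠ 0 := by omega
  have hn' : (0 : ℝ) < n := by positivity
  have hD : 0 < n * t * v + 1 := by positivity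
  set P := Measure.pi fun _ : Fin n => gaussianReal θ₀ 1
  have hL : MemLp (id : ℝ → ℝ) 2 (gaussianReal θ₀ 1) := memLp_id_gaussianReal 2
  have hX (i : Fin n) : MemLp (fun X : Fin n → ℝ => X i) 2 P :=
    hL.comp_measurePreserving (measurePreserving_eval (fun _ : Fin n => gaussianReal θ₀ 1) i)
  have hS : MemLp (fun X : Fin n → ℝ => ∑ i, X i) 2 P := memLp_finsetSum _ fun i _ => hX i
  have i1 : Integrable (fun X : Fin n → ℝ => ∑ i, X i) P := hS.integrable one_le_two
  have i2 : Integrable (fun X : Fin n → ℝ => (∑ i, X i) ^ 2) P := hS.integrable_sq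
  have i3 : Integrable (fun X : Fin n → ℝ => ∑ i, X i ^ 2) P :=
    integrable_finsetSum _ fun i _ => (hX i).integrable_sq
  have e1 : ∫ X, ∑ i, X i ∂P = n * θ₀ := by
    rw [integral_finsetSum _ fun i _ => (hX i).integrable one_le_two]
    have (i : Fin n) : ∫ X, X i ∂P = θ₀ := by
      rw [integral_eval (μ := fun _ : Fin n => gaussianReal θ₀ 1), integral_id_gaussianReal]
    simp [this]
  have e2 : ∫ X, (∑ i, X i) ^ 2 ∂P = n + (n * θ₀) ^ 2 := by
    have hV : Var[fun X : Fin n → ℝ => ∑ i, X i; P] = n := by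
      have h := variance_sum_pi (ι := Fin n) (X := fun _ => (id : ℝ → ℝ)) fun _ => hL
      simp only [variance_id_gaussianReal] at h
      convert! h using 1
      · congr 1; funext X; simp
      · simp
    rw [variance_eq_sub hS, e1] at hV
    simp only [Pi.pow_apply] at hV
    linarith
  have e3 : ∫ X, ∑ i, X i ^ 2 ∂P = n * (1 + θ₀ ^ 2) := by
    rw [integral_finsetSum _ fun i _ => (hX i).integrable_sq]
    have hV := variance_eq_sub hL
    rw [variance_id_gaussianReal] at hV
    simp only [Pi.pow_apply, id, integral_id_gaussianReal, NNReal.coe_one] at hV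
    have (i : Fin n) : ∫ X, X i ^ 2 ∂P = 1 + θ₀ ^ 2 := by
      rw [integral_comp_eval (μ := fun _ : Fin n => gaussianReal θ₀ 1) (i := i)
        (f := fun x : ℝ => x ^ 2) (by fun_prop)]
      linarith
    simp [this, mul_add]
  simp only [nuHat_eq hn0 m hv ht]
  rw [integral_add (((i3.const_mul _).fun_add (i2.const_mul _)).fun_add (i1.const_mul _))
      (integrable_const _),
    integral_add ((i3.const_mul _).fun_add (i2.const_mul _)) (i1.const_mul _),
    integral_add (i3.const_mul _) (i2.const_mul _)]
  simp only [integral_const_mul, e1, e2, e3, integral_const, probReal_univ, one_smul]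
  field_simp
  ring
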